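/- arXiv:1007.4290 — 2 statements merged into one kernel-verified Lean document; each statement's English description precedes it below -/
import Mathlib

section
/- Near/far splitting lemma (the block-combination step in the proof of Theorem 2.1): let α and β be types, G : α × β → ℂ, X ⊆ α, Y ⊆ β, and let X_N ⊆ X and Y_N ⊆ Y be finite subsets. If G admits a rank-J ε-separable approximation on (X ∖ X_N) × (Y ∖ Y_N) for some ε ≥ 0 and J ∈ ℕ, then G admits a rank-(|X_N| + |Y_N| + J) ε-separable approximation on X × Y. -/
/-- `G` admits a rank-`R` `ε`-separable approximation on `X × Y`. -/
def SepApprox {α β : Type*} (G : α × β → ℂ) (X : Set α) (Y : Set β)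
    (R : ℕ) (ε : ℝ) : Prop :=
  ∃ (a : Fin R → α → ℂ) (b : Fin R → β → ℂ),
    ∀ x ∈ X, ∀ y ∈ Y, ‖G (x, y) - ∑ r, a r x * b r y‖ ≤ ε

/-- **Near/far splitting lemma** (the block-combination step in the proof of
Theorem 2.1).  If `G` admits a rank-`J` `ε`-separable approximation on
`(X ∖ X_N) × (Y ∖ Y_N)` with `X_N ⊆ X`, `Y_N ⊆ Y` finite, then `G` admits a
rank-`(|X_N| + |Y_N| + J)` `ε`-separable approximation on `X × Y`. -/
theorem near_far_splitting_sep_approx {α β : Type*}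
    (G : α × β → ℂ) (X : Set α) (Y : Set β)
    (XN : Finset α) (YN : Finset β)
    (hXN : ↑XN ⊆ X) (hYN : ↑YN ⊆ Y)
    (ε : ℝ) (hε : 0 ≤ ε) (J : ℕ)
    (hfar : SepApprox G (X \ ↑XN) (Y \ ↑YN) J ε) :
    SepApprox G X Y (XN.card + YN.card + J) ε := by
  classical
  obtain ⟨a, b, hab⟩ := hfar
  have hcard : Fintype.card ((XN ⊕ YN) ⊕ Fin J) = XN.card + YN.card + J := by simp
  let e : ((XN ⊕ YN) ⊕ Fin J) ≃ Fin (XN.card + YN.card + J) := Fintype.equivFinOfCardEq hcard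
  let A : ((XN ⊕ YN) ⊕ Fin J) → α → ℂ := fun k x => match k with
    | .inl (.inl i) => if x = i.1 then 1 else 0
    | .inl (.inr j) => if x ∈ XN then 0 else G (x, j.1)
    | .inr r => if x ∈ XN then 0 else a r x
  let B : ((XN ⊕ YN) ⊕ Fin J) → β → ℂ := fun k y => match k with
    | .inl (.inl i) => G (i.1, y)
    | .inl (.inr j) => if y = j.1 then 1 else 0
    | .inr r => if y ∈ YN then 0 else b r y
  refine ⟨fun r => A (e.symm r), fun r => B (e.symm r), fun x hx y hy => ?_⟩
  have hsum : ∑ r, A (e.symm r) x * B (e.symm r) y = ∑ k, A k x * B k y :=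
    Equiv.sum_comp e.symm (fun k => A k x * B k y)
  have h1 : ∑ i : XN, (if x = i.1 then (1 : ℂ) else 0) * G (i.1, y)
      = if x ∈ XN then G (x, y) else 0 := by
    rw [Finset.sum_coe_sort XN (fun i => (if x = i then (1 : ℂ) else 0) * G (i, y))]
    simp
  have h2 : ∑ j : YN, (if x ∈ XN then 0 else G (x, j.1)) * (if y = j.1 then (1 : ℂ) else 0)
      = if y ∈ YN then (if x ∈ XN then 0 else G (x, y)) else 0 := by
    rw [Finset.sum_coe_sort YN
      (fun j => (if x ∈ XN then 0 else G (x, j)) * (if y = j then (1 : ℂ) else 0))]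
    simp
  rw [hsum, Fintype.sum_sum_type, Fintype.sum_sum_type]
  simp only [A, B]
  rw [h1, h2]
  by_cases hxN : x ∈ XN
  · simpa [hxN] using hε
  · by_cases hyN : y ∈ YN
    · simpa [hxN, hyN] using hε
    · simpa [hxN, hyN] using hab x ⟨hx, by simpa using hxN⟩ y ⟨hy, by simpa using hyN⟩
end

section
/- Structural form of Theorem 2.1 (low-rank separability of the image-kernel, with the Hankel-function approximation of Theorem 2.2 abstracted as a hypothesis): let α and β be types, K : α × β → ℂ, M : β → β, X ⊆ α, Y ⊆ β, let X_N ⊆ X and Y_N ⊆ Y be finite subsets, and let ε ≥ 0 and J ∈ ℕ. Suppose K admits a rank-J (ε/2)-separable approximation on (X ∖ X_N) × ((Y ∖ Y_N) ∪ M(Y ∖ Y_N)). Then the function G : α × β → ℂ defined by G(x,y) = K(x,y) − K(x, M(y)) admits a rank-R ε-separable approximation on X × Y with R = |X_N| + |Y_N| + J. -/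
/-- **Structural form of Theorem 2.1** (low-rank separability of the
image-kernel, with the Hankel-function approximation of Theorem 2.2 abstracted
as a hypothesis).  If the free-space kernel `K` admits a rank-`J`
`(ε/2)`-separable approximation on
`(X ∖ X_N) × ((Y ∖ Y_N) ∪ M(Y ∖ Y_N))`, then the image kernel
`G(x,y) = K(x,y) − K(x, M(y))` admits a rank-`(|X_N| + |Y_N| + J)`
`ε`-separable approximation on `X × Y`. -/
theorem image_kernel_low_rank {α β : Type*}
    (K : α × β → ℂ) (M : β → β) (X : Set α) (Y : Set β)
    (XN : Finset α) (YN : Finset β)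
    (hXN : ↑XN ⊆ X) (hYN : ↑YN ⊆ Y)
    (ε : ℝ) (hε : 0 ≤ ε) (J : ℕ)
    (hfar : SepApprox K (X \ ↑XN) ((Y \ ↑YN) ∪ M '' (Y \ ↑YN)) J (ε / 2)) :
    SepApprox (fun p : α × β => K p - K (p.1, M p.2)) X Y
      (XN.card + YN.card + J) ε := by
  classical
  obtain ⟨a, b, h⟩ := hfar
  let G : α → β → ℂ := fun x y => K (x, y) - K (x, M y)
  let A : (XN ⊕ YN) ⊕ Fin J → α → ℂ := fun s x => match s with
    | .inl (.inl i) => if x = i.1 then 1 else 0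
    | .inl (.inr j) => if x ∈ XN then 0 else G x j.1
    | .inr r => if x ∈ XN then 0 else a r x
  let B : (XN ⊕ YN) ⊕ Fin J → β → ℂ := fun s y => match s with
    | .inl (.inl i) => G i.1 y
    | .inl (.inr j) => if y = j.1 then 1 else 0
    | .inr r => if y ∈ YN then 0 else b r y - b r (M y)
  have hc : Fintype.card ((XN ⊕ YN) ⊕ Fin J) = XN.card + YN.card + J := by simp
  let e := Fintype.equivFinOfCardEq hc
  refine ⟨fun r => A (e.symm r), fun r => B (e.symm r), fun x hx y hy => ?_⟩
  rw [Equiv.sum_comp e.symm (fun s => A s x * B s y), Fintype.sum_sum_type,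
    Fintype.sum_sum_type]
  have h1 : ∑ i : XN, A (.inl (.inl i)) x * B (.inl (.inl i)) y
      = if x ∈ XN then G x y else 0 := by
    simp only [A, B]
    rw [Finset.sum_coe_sort XN (fun i => (if x = i then (1 : ℂ) else 0) * G i y)]
    simp
  have h2 : ∑ j : YN, A (.inl (.inr j)) x * B (.inl (.inr j)) y
      = if y ∈ YN then (if x ∈ XN then 0 else G x y) else 0 := by
    simp only [A, B]
    rw [Finset.sum_coe_sort YN
      (fun j => (if x ∈ XN then 0 else G x j) * (if y = j then (1 : ℂ) else 0))]
    simp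
  rw [h1, h2]
  by_cases hxN : x ∈ XN
  · simpa [A, B, G, hxN] using hε
  by_cases hyN : y ∈ YN
  · simpa [A, B, G, hxN, hyN] using hε
  have k1 := h x ⟨hx, by simpa using hxN⟩ y (Or.inl ⟨hy, by simpa using hyN⟩)
  have k2 := h x ⟨hx, by simpa using hxN⟩ (M y)
    (Or.inr ⟨y, ⟨hy, by simpa using hyN⟩, rfl⟩)
  simp only [A, B, hxN, hyN, if_false, zero_add, mul_sub, Finset.sum_sub_distrib]
  rw [sub_sub_sub_comm]
  exact (norm_sub_le _ _).trans (by linarith)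
end
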